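/- W.h.p. Q^n(2) contains a connected component with at least (1 − (100·ln 2)/log₂log₂ n)·2^n vertices. -/

import Mathlib

open scoped Classical
open Filter

noncomputable section

/-- The vertex set of the `n`-dimensional hypercube: `{0,1}^n`. -/
abbrev Vtx (n : ℕ) := Fin n → Bool

/-- The `n`-dimensional hypercube graph `Q^n`: two vertices are adjacent iff they
differ in exactly one coordinate. -/
def cubeGraph (n : ℕ) : SimpleGraph (Vtx n) :=
  SimpleGraph.fromRel (fun u v => hammingDist u v = 1)

/-- Sample space for the `k`-out model on `Q^n`: each vertex `v` chooses a
`k`-element set of its neighbours (equivalently, `k` incident edges). -/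
abbrev KOut (n k : ℕ) :=
  ∀ v : Vtx n, {s : Finset (Vtx n) // s.card = k ∧ ∀ u ∈ s, (cubeGraph n).Adj v u}

/-- The random subgraph `Q^n(k)` produced by an outcome of the `k`-out model:
`u` and `v` are adjacent iff one of them chose the edge between them. -/
def kOutGraph (n k : ℕ) (ω : KOut n k) : SimpleGraph (Vtx n) :=
  SimpleGraph.fromRel (fun u v => v ∈ (ω u).1)

/-- Uniform (counting) probability of an event on a finite sample space. -/
def prob {Ω : Type*} [Finite Ω] (p : Ω → Prop) : ℝ :=
  (Nat.card {ω : Ω // p ω} : ℝ) / (Nat.card Ω : ℝ)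

/-- Number of vertices in the connected component of `v` in `G`. -/
def compSize {V : Type*} (G : SimpleGraph V) (v : V) : ℕ :=
  Nat.card {w : V // G.Reachable v w}

/-- The neighbour of `v` in direction `i`. -/
def flipBit {n : ℕ} (v : Vtx n) (i : Fin n) : Vtx n := Function.update v i (!v i)

lemma flipBit_apply_self {n : ℕ} (v : Vtx n) (i : Fin n) : flipBit v i i = !v i := by
  simp [flipBit]

lemma flipBit_apply_of_ne {n : ℕ} (v : Vtx n) {i j : Fin n} (h : j ≠ i) : flipBit v i j = v j := by
  simp [flipBit, h]

lemma flipBit_flipBit {n : ℕ} (v : Vtx n) (i : Fin n) : flipBit (flipBit v i) i = v := by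
  funext j
  by_cases h : j = i
  · subst h; simp [flipBit_apply_self]
  · simp [flipBit_apply_of_ne _ h]

lemma flipBit_right_injective {n : ℕ} (v : Vtx n) : Function.Injective (flipBit v) := by
  intro i j h
  by_contra hij
  have h1 := congrFun h i
  rw [flipBit_apply_self, flipBit_apply_of_ne v hij] at h1
  simp at h1

lemma flipBit_left_injective {n : ℕ} (i : Fin n) :
    Function.Injective (fun v : Vtx n => flipBit v i) := by
  intro u v h
  have := congrArg (fun w => flipBit w i) h
  simpa [flipBit_flipBit] using this

lemma hammingDist_eq_one_iff {n : ℕ} (u v : Vtx n) :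
    hammingDist u v = 1 ↔ ∃ i, v = flipBit u i := by
  unfold hammingDist
  rw [Finset.card_eq_one]
  constructor
  · rintro ⟨i, hi⟩
    refine ⟨i, ?_⟩
    funext j
    have hj : j ∈ Finset.univ.filter (fun i => u i ≠ v i) ↔ j ∈ ({i} : Finset (Fin n)) := by
      rw [hi]
    simp only [Finset.mem_filter, Finset.mem_univ, true_and, Finset.mem_singleton] at hj
    by_cases h : j = i
    · subst h
      rw [flipBit_apply_self]
      have := hj.2 rfl
      revert this
      cases u j <;> cases v j <;> simp
    · rw [flipBit_apply_of_ne _ h]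
      by_contra h2
      exact h (hj.1 (fun h3 => h2 h3.symm))
  · rintro ⟨i, rfl⟩
    refine ⟨i, ?_⟩
    ext j
    simp only [Finset.mem_filter, Finset.mem_univ, true_and, Finset.mem_singleton]
    by_cases h : j = i
    · subst h
      simp [flipBit_apply_self]
    · simp [flipBit_apply_of_ne _ h, h]

lemma flipBit_ne {n : ℕ} (v : Vtx n) (i : Fin n) : flipBit v i ≠ v := by
  intro h
  have := congrFun h i
  rw [flipBit_apply_self] at this
  simp at this

lemma cubeGraph_adj_iff {n : ℕ} (u v : Vtx n) :
    (cubeGraph n).Adj u v ↔ ∃ i, v = flipBit u i := by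
  unfold cubeGraph
  rw [SimpleGraph.fromRel_adj, hammingDist_comm v u, or_self, hammingDist_eq_one_iff]
  constructor
  · exact fun h => h.2
  · rintro ⟨i, rfl⟩
    exact ⟨(flipBit_ne u i).symm, i, rfl⟩

/-- The parity of a vertex. -/
def OddVtx {n : ℕ} (v : Vtx n) : Prop := Odd (Finset.univ.filter (fun i => v i = true)).card

lemma oddVtx_flipBit {n : ℕ} (v : Vtx n) (i : Fin n) : OddVtx (flipBit v i) ↔ ¬ OddVtx v := by
  have key : ∀ w : Vtx n, w i = false → (OddVtx (flipBit w i) ↔ ¬ OddVtx w) := by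
    intro w hw
    have : Finset.univ.filter (fun j => flipBit w i j = true)
        = insert i (Finset.univ.filter (fun j => w j = true)) := by
      ext j
      by_cases h : j = i
      · subst h; simp [flipBit_apply_self, hw]
      · simp [flipBit_apply_of_ne _ h, h]
    unfold OddVtx
    rw [this, Finset.card_insert_of_notMem (by simp [hw]), Nat.odd_add_one]
  cases hv : v i
  · exact key v hv
  · have := key (flipBit v i) (by simp [flipBit_apply_self, hv])
    rw [flipBit_flipBit] at this
    tauto

/-- The directions from `v` leading into `T`. -/
def dirsInto {n : ℕ} (T : Finset (Vtx n)) (v : Vtx n) : Finset (Fin n) :=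
  Finset.univ.filter (fun i => flipBit v i ∈ T)

lemma mul_logb_add_le {a b : ℝ} (ha : 0 < a) (hab : a ≤ b) :
    a * Real.logb 2 a + b * Real.logb 2 b + 2 * a ≤ (a + b) * Real.logb 2 (a + b) := by
  have hb : 0 < b := ha.trans_le hab
  have h1 : 1 ≤ Real.logb 2 (a + b) - Real.logb 2 a := by
    rw [← Real.logb_div (by positivity) (by positivity), Real.le_logb_iff_rpow_le (by norm_num)
      (by positivity), Real.rpow_one, le_div_iff₀ ha]
    linarith
  have h2 : a ≤ b * (Real.logb 2 (a + b) - Real.logb 2 b) := by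
    rw [← Real.logb_div (by positivity) (by positivity)]
    have h3 : (2 : ℝ) ≤ ((a + b) / b) ^ (b / a) := by
      have := one_add_mul_self_le_rpow_one_add (s := a / b) (by have : 0 < a / b := by positivity
                                                                linarith)
        (p := b / a) (by rw [le_div_iff₀ ha]; linarith)
      have e1 : 1 + b / a * (a / b) = 2 := by field_simp; norm_num
      have e2 : 1 + a / b = (a + b) / b := by field_simp; ring
      rwa [e1, e2] at this
    have h4 := (Real.le_logb_iff_rpow_le (b := 2) (x := 1) (y := ((a + b) / b) ^ (b / a))
      (by norm_num) (by positivity)).2 (by simpa using h3)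
    rw [Real.logb_rpow_eq_mul_logb_of_pos (by positivity)] at h4
    have h5 := mul_le_mul_of_nonneg_left h4 ha.le
    have e3 : a * (b / a * Real.logb 2 ((a + b) / b)) = b * Real.logb 2 ((a + b) / b) := by
      field_simp
    linarith
  nlinarith

lemma card_mul_logb_split (a b : ℕ) :
    (a : ℝ) * Real.logb 2 a + b * Real.logb 2 b + 2 * (min a b : ℕ)
      ≤ ((a + b : ℕ) : ℝ) * Real.logb 2 ((a + b : ℕ) : ℝ) := by
  wlog hab : a ≤ b generalizing a b
  · have := this b a (by omega)
    rw [min_comm, add_comm a b]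
    linarith
  rw [min_eq_left hab]
  rcases Nat.eq_zero_or_pos a with rfl | ha
  · simp
  · push_cast
    exact mul_logb_add_le (by exact_mod_cast ha) (by exact_mod_cast hab)

/-- Edge-isoperimetry in the cube, restricted to a set `I` of directions. -/
lemma sum_card_dirs_le {n : ℕ} (I : Finset (Fin n)) (T : Finset (Vtx n)) :
    ∑ v ∈ T, ((I.filter (fun i => flipBit v i ∈ T)).card : ℝ) ≤ T.card * Real.logb 2 T.card := by
  induction I using Finset.induction_on generalizing T with
  | empty =>
    simp only [Finset.filter_empty, Finset.card_empty, Nat.cast_zero, Finset.sum_const_zero]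
    rcases Nat.eq_zero_or_pos T.card with h | h
    · simp [h]
    · exact mul_nonneg (by positivity) (Real.logb_nonneg (by norm_num) (by exact_mod_cast h))
  | insert k I hk ih =>
    set T0 := T.filter (fun v => v k = false) with hT0
    set T1 := T.filter (fun v => ¬ v k = false) with hT1
    have hcard : T0.card + T1.card = T.card := Finset.card_filter_add_card_filter_not _
    have hsplit : ∀ v ∈ T, (((insert k I).filter (fun i => flipBit v i ∈ T)).card : ℝ)
        = (I.filter (fun i => flipBit v i ∈ T)).card + (if flipBit v k ∈ T then 1 else 0) := by
      intro v _
      rw [Finset.filter_insert]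
      split_ifs with h
      · rw [Finset.card_insert_of_notMem (by simp [hk])]; push_cast; ring
      · simp
    rw [Finset.sum_congr rfl hsplit, Finset.sum_add_distrib]
    have hA : ∑ v ∈ T, ((I.filter (fun i => flipBit v i ∈ T)).card : ℝ)
        ≤ T0.card * Real.logb 2 T0.card + T1.card * Real.logb 2 T1.card := by
      rw [← Finset.sum_filter_add_sum_filter_not T (fun v => v k = false)]
      refine add_le_add ((Finset.sum_congr rfl ?_).trans_le (ih T0))
        ((Finset.sum_congr rfl ?_).trans_le (ih T1))
      all_goals
        intro v hv
        rw [Finset.mem_filter] at hv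
        congr 2
        apply Finset.filter_congr
        intro i hi
        have hki : k ≠ i := fun h => hk (h ▸ hi)
        simp only [hT0, hT1, Finset.mem_filter, flipBit_apply_of_ne v hki]
        exact ⟨fun h => ⟨h, hv.2⟩, fun h => h.1⟩
    have hinj : Set.InjOn (fun v : Vtx n => flipBit v k) Set.univ :=
      (flipBit_left_injective k).injOn
    have hB : ∑ v ∈ T, (if flipBit v k ∈ T then (1 : ℝ) else 0)
        ≤ 2 * (min T0.card T1.card : ℕ) := by
      rw [Finset.sum_boole]
      have h0 : ((T.filter (fun v => flipBit v k ∈ T)).filter (fun v => v k = false)).card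
          ≤ min T0.card T1.card := by
        refine le_min (Finset.card_le_card fun v hv => ?_)
          (Finset.card_le_card_of_injOn (fun v => flipBit v k) (fun v hv => ?_)
            (hinj.mono (Set.subset_univ _)))
        · simp only [Finset.mem_filter, hT0] at hv ⊢
          exact ⟨hv.1.1, hv.2⟩
        · simp only [Finset.coe_filter, Finset.mem_filter, Set.mem_ofPred_eq, hT1,
            flipBit_apply_self] at hv ⊢
          exact ⟨hv.1.2, by simp [hv.2]⟩
      have h1 : ((T.filter (fun v => flipBit v k ∈ T)).filter (fun v => ¬ v k = false)).card
          ≤ min T0.card T1.card := by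
        refine le_min (Finset.card_le_card_of_injOn (fun v => flipBit v k) (fun v hv => ?_)
            (hinj.mono (Set.subset_univ _))) (Finset.card_le_card fun v hv => ?_)
        · simp only [Finset.coe_filter, Finset.mem_filter, Set.mem_ofPred_eq, hT0,
            flipBit_apply_self] at hv ⊢
          exact ⟨hv.1.2, by simpa using hv.2⟩
        · simp only [Finset.mem_filter, hT1] at hv ⊢
          exact ⟨hv.1.1, hv.2⟩
      have h2 := Finset.card_filter_add_card_filter_not
        (s := T.filter (fun v => flipBit v k ∈ T)) (fun v => v k = false)
      have h3 : (T.filter (fun v => flipBit v k ∈ T)).card ≤ 2 * min T0.card T1.card := by omega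
      exact_mod_cast h3
    have hC := card_mul_logb_split T0.card T1.card
    rw [hcard] at hC
    linarith

lemma sum_card_dirsInto_le {n : ℕ} (T : Finset (Vtx n)) :
    ∑ v ∈ T, ((dirsInto T v).card : ℝ) ≤ T.card * Real.logb 2 T.card :=
  sum_card_dirs_le Finset.univ T

/-- Every vertex of `T` is reached from `v` by a walk of the cube inside `T`. -/
def ConnectedFrom {n : ℕ} (v : Vtx n) (T : Finset (Vtx n)) : Prop :=
  v ∈ T ∧ ∀ w ∈ T, Relation.ReflTransGen (fun a b => (∃ i, b = flipBit a i) ∧ b ∈ T) v w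

/-- The site-percolation cluster of `v` when the open sites are those in `U`. -/
def cluster {n : ℕ} (U : Vtx n → Prop) (v : Vtx n) : Finset (Vtx n) :=
  Finset.univ.filter
    (Relation.ReflTransGen (fun a b => (∃ i, b = flipBit a i) ∧ (U b ∨ b = v)) v)

/-- The outer vertex boundary of `T` in the cube. -/
def outerBoundary {n : ℕ} (T : Finset (Vtx n)) : Finset (Vtx n) :=
  (T.biUnion (fun v => Finset.univ.image (flipBit v))) \ T

lemma card_outerBoundary_le {n : ℕ} (T : Finset (Vtx n)) :
    (outerBoundary T).card ≤ n * T.card := by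
  refine (Finset.card_le_card Finset.sdiff_subset).trans ?_
  rw [mul_comm]
  refine Finset.card_biUnion_le_card_mul _ _ _ fun v _ => ?_
  exact Finset.card_image_le.trans (by simp)

lemma cluster_eq {n : ℕ} {v : Vtx n} {T : Finset (Vtx n)} (hT : ConnectedFrom v T)
    {U : Vtx n → Prop} (h1 : ∀ x ∈ T.erase v, U x) (h2 : ∀ x ∈ outerBoundary T, ¬ U x) :
    cluster U v = T := by
  ext w
  simp only [cluster, Finset.mem_filter, Finset.mem_univ, true_and]
  constructor
  · intro h
    induction h with
    | refl => exact hT.1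
    | @tail b c _ hbc ih =>
      obtain ⟨⟨i, hi⟩, hc⟩ := hbc
      rcases hc with hc | hc
      · by_contra hcT
        refine h2 c ?_ hc
        simp only [outerBoundary, Finset.mem_sdiff, Finset.mem_biUnion, Finset.mem_image,
          Finset.mem_univ, true_and]
        exact ⟨⟨b, ih, i, hi.symm⟩, hcT⟩
      · exact hc ▸ hT.1
  · intro h
    refine Relation.ReflTransGen.mono ?_ _ _ (hT.2 w h)
    rintro a b ⟨hab, hb⟩
    refine ⟨hab, ?_⟩
    by_cases hbv : b = v
    · exact Or.inr hbv
    · exact Or.inl (h1 b (Finset.mem_erase.2 ⟨hbv, hb⟩))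

lemma card_cluster_eq_ge {n : ℕ} {v : Vtx n} {T : Finset (Vtx n)} (hT : ConnectedFrom v T) :
    ((n : ℝ) + 1) ^ Fintype.card (Vtx n) *
        ((1 / ((n : ℝ) + 1)) ^ (T.card - 1) * ((n : ℝ) / (n + 1)) ^ (n * T.card))
      ≤ ((Finset.univ.filter
          (fun φ : Vtx n → Fin (n + 1) => cluster (fun x => φ x = 0) v = T)).card : ℝ) := by
  set t : Vtx n → Finset (Fin (n + 1)) := fun x =>
    if x ∈ T.erase v then {0} else if x ∈ outerBoundary T then {0}ᶜ else Finset.univ with ht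
  have hsub : Fintype.piFinset t ⊆ Finset.univ.filter
      (fun φ : Vtx n → Fin (n + 1) => cluster (fun x => φ x = 0) v = T) := by
    intro φ hφ
    rw [Fintype.mem_piFinset] at hφ
    rw [Finset.mem_filter]
    refine ⟨Finset.mem_univ _, cluster_eq hT (fun x hx => ?_) (fun x hx => ?_)⟩
    · have := hφ x
      simpa [ht, hx, -Finset.mem_erase] using this
    · have := hφ x
      have hx' : x ∉ T.erase v := fun h =>
        (Finset.mem_sdiff.1 hx).2 (Finset.mem_of_mem_erase h)
      simpa [ht, hx, hx', -Finset.mem_erase] using this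
  have hcard : ∀ x, ((t x).card : ℝ) = ((n : ℝ) + 1) *
      ((if x ∈ T.erase v then 1 / ((n : ℝ) + 1) else 1) *
        (if x ∈ outerBoundary T then (n : ℝ) / (n + 1) else 1)) := by
    intro x
    have hn : (n : ℝ) + 1 ≠ 0 := by positivity
    simp only [ht]
    by_cases hx : x ∈ T.erase v
    · have hx' : x ∉ outerBoundary T := fun h =>
        (Finset.mem_sdiff.1 h).2 (Finset.mem_of_mem_erase hx)
      simp only [if_pos hx, if_neg hx', Finset.card_singleton]
      field_simp
      norm_num
    · by_cases hx' : x ∈ outerBoundary T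
      · simp only [if_neg hx, if_pos hx', Finset.card_compl, Finset.card_singleton,
          Fintype.card_fin, Nat.add_sub_cancel]
        field_simp
      · simp only [if_neg hx, if_neg hx', Finset.card_univ, Fintype.card_fin]
        push_cast
        ring
  have h3 : ((Fintype.piFinset t).card : ℝ) = ((n : ℝ) + 1) ^ Fintype.card (Vtx n) *
        ((1 / ((n : ℝ) + 1)) ^ (T.card - 1) *
          ((n : ℝ) / (n + 1)) ^ (outerBoundary T).card) := by
    rw [Fintype.card_piFinset, Nat.cast_prod, Finset.prod_congr rfl (fun x _ => hcard x),
      Finset.prod_mul_distrib, Finset.prod_mul_distrib, Finset.prod_const, Finset.card_univ,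
      Finset.prod_ite_mem, Finset.prod_ite_mem, Finset.univ_inter, Finset.univ_inter,
      Finset.prod_const, Finset.prod_const, Finset.card_erase_of_mem hT.1]
  refine le_trans ?_ (Nat.cast_le.2 (Finset.card_le_card hsub))
  rw [h3]
  have hle : (n : ℝ) / (n + 1) ≤ 1 := by
    rw [div_le_one (by positivity)]; linarith
  gcongr _ * (_ * ?_)
  exact pow_le_pow_of_le_one (by positivity) hle (card_outerBoundary_le T)

lemma one_third_le_pow (n : ℕ) : (1 : ℝ) / 3 ≤ ((n : ℝ) / (n + 1)) ^ n := by
  rcases Nat.eq_zero_or_pos n with rfl | hn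
  · norm_num
  have hn' : (0 : ℝ) < n := by exact_mod_cast hn
  have h1 : (1 + 1 / (n : ℝ)) ^ n ≤ 3 := by
    calc (1 + 1 / (n : ℝ)) ^ n ≤ (Real.exp (1 / n)) ^ n := by
          gcongr
          linarith [Real.add_one_le_exp (1 / (n : ℝ))]
      _ = Real.exp 1 := by
          rw [← Real.exp_nat_mul]; congr 1; field_simp
      _ ≤ 3 := by linarith [Real.exp_one_lt_d9]
  have e : (n : ℝ) / (n + 1) = (1 + 1 / (n : ℝ))⁻¹ := by field_simp
  rw [e, inv_pow, one_div]
  exact inv_anti₀ (by positivity) h1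

lemma sum_connectedFrom_le {n : ℕ} (v : Vtx n) (F : Finset (Finset (Vtx n)))
    (hF : ∀ T ∈ F, ConnectedFrom v T) :
    ∑ T ∈ F, (1 / ((n : ℝ) + 1)) ^ (T.card - 1) * (1 / 3 : ℝ) ^ T.card ≤ 1 := by
  have hpos : (0 : ℝ) < ((n : ℝ) + 1) ^ Fintype.card (Vtx n) := by positivity
  have h1 : ∑ T ∈ F, ((Finset.univ.filter
      (fun φ : Vtx n → Fin (n + 1) => cluster (fun x => φ x = 0) v = T)).card : ℝ)
        ≤ ((n : ℝ) + 1) ^ Fintype.card (Vtx n) := by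
    have := (Finset.sum_card_fiberwise_eq_card_filter
      (Finset.univ : Finset (Vtx n → Fin (n + 1))) F
      (fun φ => cluster (fun x => φ x = 0) v)).trans_le (Finset.card_filter_le _ _)
    have h2 : Fintype.card (Vtx n → Fin (n + 1)) = (n + 1) ^ Fintype.card (Vtx n) := by
      simp
    rw [Finset.card_univ, h2] at this
    exact_mod_cast this
  refine le_of_mul_le_mul_left ?_ hpos
  rw [mul_one, Finset.mul_sum]
  refine le_trans (Finset.sum_le_sum fun T hT => ?_) h1
  refine le_trans ?_ (card_cluster_eq_ge (hF T hT))
  rw [pow_mul]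
  gcongr
  exact one_third_le_pow n

/-- The choices revealed first: each vertex has a first choice `p.1` and a second choice
`p.1.succAbove p.2`; the second one is used at odd vertices only. -/
abbrev Stage1 (m : ℕ) := Vtx (m + 1) → Fin (m + 1) × Fin m

/-- `w` is chosen by `u` among the choices revealed first. -/
def Step {m : ℕ} (z : Stage1 m) (u w : Vtx (m + 1)) : Prop :=
  w = flipBit u (z u).1 ∨ (OddVtx u ∧ w = flipBit u ((z u).1.succAbove (z u).2))

/-- `T` is closed under the choices revealed first. -/
def StepClosed {m : ℕ} (z : Stage1 m) (T : Finset (Vtx (m + 1))) : Prop :=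
  ∀ u ∈ T, ∀ w, Step z u w → w ∈ T

/-- The vertices reached from `v` by following the choices revealed first. -/
def reachSet {m : ℕ} (z : Stage1 m) (v : Vtx (m + 1)) : Finset (Vtx (m + 1)) :=
  Finset.univ.filter (Relation.ReflTransGen (Step z) v)

lemma mem_reachSet_self {m : ℕ} (z : Stage1 m) (v : Vtx (m + 1)) : v ∈ reachSet z v := by
  simp only [reachSet, Finset.mem_filter, Finset.mem_univ, true_and]
  exact Relation.ReflTransGen.refl

lemma stepClosed_reachSet {m : ℕ} (z : Stage1 m) (v : Vtx (m + 1)) :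
    StepClosed z (reachSet z v) := by
  intro u hu w huw
  simp only [reachSet, Finset.mem_filter, Finset.mem_univ, true_and] at hu ⊢
  exact hu.tail huw

lemma Step.exists_flipBit {m : ℕ} {z : Stage1 m} {u w : Vtx (m + 1)} (h : Step z u w) :
    ∃ i, w = flipBit u i := by
  rcases h with h | h
  · exact ⟨_, h⟩
  · exact ⟨_, h.2⟩

lemma connectedFrom_reachSet {m : ℕ} (z : Stage1 m) (v : Vtx (m + 1)) :
    ConnectedFrom v (reachSet z v) := by
  refine ⟨mem_reachSet_self z v, fun w hw => ?_⟩
  simp only [reachSet, Finset.mem_filter, Finset.mem_univ, true_and] at hw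
  induction hw with
  | refl => exact Relation.ReflTransGen.refl
  | @tail b c hb hbc ih =>
    refine ih.tail ⟨hbc.exists_flipBit, ?_⟩
    simp only [reachSet, Finset.mem_filter, Finset.mem_univ, true_and]
    exact hb.tail hbc

lemma card_odd_reachSet_pos {m : ℕ} (z : Stage1 m) (v : Vtx (m + 1)) :
    1 ≤ ((reachSet z v).filter OddVtx).card := by
  rw [Nat.one_le_iff_ne_zero, Finset.card_ne_zero]
  by_cases hv : OddVtx v
  · exact ⟨v, Finset.mem_filter.2 ⟨mem_reachSet_self z v, hv⟩⟩
  · refine ⟨flipBit v (z v).1, Finset.mem_filter.2 ⟨?_, (oddVtx_flipBit _ _).2 hv⟩⟩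
    exact stepClosed_reachSet z v v (mem_reachSet_self z v) _ (Or.inl rfl)

lemma card_reachSet_le {m : ℕ} (z : Stage1 m) (v : Vtx (m + 1)) :
    (reachSet z v).card ≤ 4 * ((reachSet z v).filter OddVtx).card := by
  set O := (reachSet z v).filter OddVtx with hO
  have hsub : reachSet z v ⊆ insert v (O ∪ (O.image (fun u => flipBit u (z u).1) ∪
      O.image (fun u => flipBit u ((z u).1.succAbove (z u).2)))) := by
    intro w hw
    by_cases hodd : OddVtx w
    · simp [hO, hw, hodd]
    have hw' := hw
    simp only [reachSet, Finset.mem_filter, Finset.mem_univ, true_and] at hw'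
    rcases Relation.ReflTransGen.cases_tail hw' with h | ⟨u, hu, huw⟩
    · simp [h]
    · have huO : OddVtx u := by
        obtain ⟨i, hi⟩ := huw.exists_flipBit
        by_contra h
        exact hodd (hi ▸ (oddVtx_flipBit u i).2 h)
      have huR : u ∈ O := by
        rw [hO, Finset.mem_filter]
        exact ⟨by simpa [reachSet] using hu, huO⟩
      simp only [Finset.mem_insert, Finset.mem_union, Finset.mem_image]
      rcases huw with h | h
      · exact Or.inr (Or.inr (Or.inl ⟨u, huR, h.symm⟩))
      · exact Or.inr (Or.inr (Or.inr ⟨u, huR, h.2.symm⟩))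
  have h1 := Finset.card_le_card hsub
  have h2 := Finset.card_insert_le v (O ∪ (O.image (fun u => flipBit u (z u).1) ∪
      O.image (fun u => flipBit u ((z u).1.succAbove (z u).2))))
  have h3 := Finset.card_union_le O (O.image (fun u => flipBit u (z u).1) ∪
      O.image (fun u => flipBit u ((z u).1.succAbove (z u).2)))
  have h4 := Finset.card_union_le (O.image (fun u => flipBit u (z u).1))
      (O.image (fun u => flipBit u ((z u).1.succAbove (z u).2)))
  have h5 : (O.image (fun u => flipBit u (z u).1)).card ≤ O.card := Finset.card_image_le
  have h6 : (O.image (fun u => flipBit u ((z u).1.succAbove (z u).2))).card ≤ O.card :=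
    Finset.card_image_le
  have h7 : 1 ≤ O.card := card_odd_reachSet_pos z v
  omega

lemma card_local_closed_le {m : ℕ} (hm : 1 ≤ m) (D : Finset (Fin (m + 1))) (P : Prop) :
    ((Finset.univ.filter (fun p : Fin (m + 1) × Fin m =>
        p.1 ∈ D ∧ (P → p.1.succAbove p.2 ∈ D))).card : ℝ)
      ≤ (((m : ℝ) + 1) * m) *
        ((D.card : ℝ) / ((m : ℝ) + 1) * (if P then (D.card : ℝ) / m else 1)) := by
  have hm' : (0 : ℝ) < m := by exact_mod_cast hm
  by_cases hP : P
  · have hle : (Finset.univ.filter (fun p : Fin (m + 1) × Fin m =>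
        p.1 ∈ D ∧ (P → p.1.succAbove p.2 ∈ D))).card ≤ (D ×ˢ D).card := by
      refine Finset.card_le_card_of_injOn (fun p => (p.1, p.1.succAbove p.2)) ?_ ?_
      · intro p hp
        simp only [Finset.coe_filter, Finset.mem_univ, true_and, Set.mem_ofPred_eq] at hp
        simp [hp.1, hp.2 hP]
      · rintro ⟨a, b⟩ _ ⟨c, d⟩ _ h
        simp only [Prod.mk.injEq] at h
        obtain ⟨rfl, h⟩ := h
        simpa using h
    have hle' : _ ≤ ((D ×ˢ D).card : ℝ) := Nat.cast_le.2 hle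
    refine hle'.trans (le_of_eq ?_)
    rw [if_pos hP, Finset.card_product]
    push_cast
    field_simp
  · have hle : (Finset.univ.filter (fun p : Fin (m + 1) × Fin m =>
        p.1 ∈ D ∧ (P → p.1.succAbove p.2 ∈ D))).card
          ≤ (D ×ˢ (Finset.univ : Finset (Fin m))).card := by
      refine Finset.card_le_card fun p hp => ?_
      simp only [Finset.mem_filter] at hp
      simp [hp.2.1]
    have hle' : _ ≤ ((D ×ˢ (Finset.univ : Finset (Fin m))).card : ℝ) := Nat.cast_le.2 hle
    refine hle'.trans (le_of_eq ?_)
    rw [if_neg hP, Finset.card_product]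
    simp only [Finset.card_univ, Fintype.card_fin]
    push_cast
    field_simp

lemma card_stage1 (m : ℕ) :
    (Fintype.card (Stage1 m) : ℝ) = (((m : ℝ) + 1) * m) ^ Fintype.card (Vtx (m + 1)) := by
  rw [Fintype.card_pi]
  simp

lemma card_stepClosed_le {m : ℕ} (hm : 1 ≤ m) (T : Finset (Vtx (m + 1))) :
    ((Finset.univ.filter (fun z : Stage1 m => StepClosed z T)).card : ℝ)
      ≤ Fintype.card (Stage1 m) * ∏ v ∈ T, (((dirsInto T v).card : ℝ) / ((m : ℝ) + 1) *
          (if OddVtx v then ((dirsInto T v).card : ℝ) / m else 1)) := by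
  have hm' : (0 : ℝ) < m := by exact_mod_cast hm
  set t : Vtx (m + 1) → Finset (Fin (m + 1) × Fin m) := fun v =>
    if v ∈ T then Finset.univ.filter (fun p : Fin (m + 1) × Fin m =>
      p.1 ∈ dirsInto T v ∧ (OddVtx v → p.1.succAbove p.2 ∈ dirsInto T v)) else Finset.univ with ht
  have hsub : Finset.univ.filter (fun z : Stage1 m => StepClosed z T) ⊆ Fintype.piFinset t := by
    intro z hz
    rw [Finset.mem_filter] at hz
    rw [Fintype.mem_piFinset]
    intro v
    by_cases hv : v ∈ T
    · simp only [ht, if_pos hv, Finset.mem_filter, Finset.mem_univ, true_and, dirsInto]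
      exact ⟨hz.2 v hv _ (Or.inl rfl), fun ho => hz.2 v hv _ (Or.inr ⟨ho, rfl⟩)⟩
    · simp [ht, if_neg hv]
  have hcard : ∀ v, ((t v).card : ℝ) ≤ (((m : ℝ) + 1) * m) *
      (if v ∈ T then (((dirsInto T v).card : ℝ) / ((m : ℝ) + 1) *
          (if OddVtx v then ((dirsInto T v).card : ℝ) / m else 1)) else 1) := by
    intro v
    by_cases hv : v ∈ T
    · simp only [ht, if_pos hv]
      exact card_local_closed_le hm _ _
    · simp [ht, if_neg hv]
  refine (Nat.cast_le.2 (Finset.card_le_card hsub)).trans ?_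
  rw [Fintype.card_piFinset, Nat.cast_prod, card_stage1]
  refine (Finset.prod_le_prod (fun _ _ => by positivity) (fun v _ => hcard v)).trans (le_of_eq ?_)
  rw [Finset.prod_mul_distrib, Finset.prod_const, Finset.card_univ, Finset.prod_ite_mem,
    Finset.univ_inter]

lemma prod_card_dirsInto_le {n : ℕ} (T : Finset (Vtx n)) {l : ℝ} (hl : 0 < l)
    (hT : Real.logb 2 T.card ≤ l) : ∏ v ∈ T, ((dirsInto T v).card : ℝ) ≤ l ^ T.card := by
  have h1 : ∏ v ∈ T, (((dirsInto T v).card : ℝ) / l) ≤ 1 := by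
    calc ∏ v ∈ T, (((dirsInto T v).card : ℝ) / l)
        ≤ ∏ v ∈ T, Real.exp (((dirsInto T v).card : ℝ) / l - 1) := by
          refine Finset.prod_le_prod (fun _ _ => by positivity) fun v _ => ?_
          linarith [Real.add_one_le_exp (((dirsInto T v).card : ℝ) / l - 1)]
      _ = Real.exp (∑ v ∈ T, (((dirsInto T v).card : ℝ) / l - 1)) := (Real.exp_sum _ _).symm
      _ ≤ 1 := by
          rw [Real.exp_le_one_iff, Finset.sum_sub_distrib, ← Finset.sum_div, Finset.sum_const,
            nsmul_eq_mul, mul_one, sub_nonpos, div_le_iff₀ hl]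
          exact (sum_card_dirsInto_le T).trans (by gcongr)
  rw [Finset.prod_div_distrib, Finset.prod_const, div_le_one (by positivity)] at h1
  exact h1

lemma prod_weight_le {m : ℕ} (hm : 1 ≤ m) (T : Finset (Vtx (m + 1))) {l : ℝ} (hl : 0 < l)
    (hT : Real.logb 2 T.card ≤ l) :
    ∏ v ∈ T, (((dirsInto T v).card : ℝ) / ((m : ℝ) + 1) *
          (if OddVtx v then ((dirsInto T v).card : ℝ) / m else 1))
      ≤ (l ^ 2 / ((m : ℝ) + 1)) ^ T.card * (2 / ((m : ℝ) + 1)) ^ (T.filter OddVtx).card := by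
  have hm' : (1 : ℝ) ≤ m := by exact_mod_cast hm
  by_cases h0 : ∃ v ∈ T, (dirsInto T v).card = 0
  · obtain ⟨v, hv, hv0⟩ := h0
    rw [Finset.prod_eq_zero hv (by simp [hv0])]
    positivity
  push Not at h0
  have hterm : ∀ v ∈ T, ((dirsInto T v).card : ℝ) / ((m : ℝ) + 1) *
          (if OddVtx v then ((dirsInto T v).card : ℝ) / m else 1)
      ≤ ((dirsInto T v).card : ℝ) * (dirsInto T v).card * (1 / ((m : ℝ) + 1)) *
        (if OddVtx v then 2 / ((m : ℝ) + 1) else 1) := by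
    intro v hv
    have hd : (1 : ℝ) ≤ (dirsInto T v).card := by
      exact_mod_cast Nat.one_le_iff_ne_zero.2 (h0 v hv)
    set d : ℝ := ((dirsInto T v).card : ℝ)
    split_ifs
    · have : d / m ≤ d * (2 / (m + 1)) := by
        rw [mul_div_assoc', div_le_div_iff₀ (by positivity) (by positivity)]
        nlinarith
      calc d / (m + 1) * (d / m) ≤ d / (m + 1) * (d * (2 / (m + 1))) := by gcongr
        _ = _ := by ring
    · rw [mul_one, mul_one, mul_one_div]
      gcongr
      nlinarith
  refine (Finset.prod_le_prod (fun _ _ => by positivity) hterm).trans ?_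
  rw [Finset.prod_mul_distrib, Finset.prod_mul_distrib, Finset.prod_mul_distrib,
    Finset.prod_const, ← Finset.prod_filter, Finset.prod_const]
  have hp := prod_card_dirsInto_le T hl hT
  have hp0 : (0 : ℝ) ≤ ∏ v ∈ T, ((dirsInto T v).card : ℝ) := by positivity
  have he : (l ^ 2 / ((m : ℝ) + 1)) ^ T.card
      = l ^ T.card * l ^ T.card * (1 / ((m : ℝ) + 1)) ^ T.card := by
    rw [← mul_pow, ← mul_pow]
    congr 1
    ring
  rw [he]
  gcongr

/-- For fixed `v`, few outcomes give `v` a small set of reachable vertices. -/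
lemma card_small_reachSet_le {m : ℕ} (hm : 1 ≤ m) (v : Vtx (m + 1)) (M : ℕ) {l : ℝ} (hl : 1 ≤ l)
    (hM : Real.logb 2 M ≤ l) (hq : (6 * l ^ 2) ^ 4 * 2 / ((m : ℝ) + 1) ≤ 1) :
    ((Finset.univ.filter (fun z : Stage1 m => (reachSet z v).card < M)).card : ℝ)
      ≤ Fintype.card (Stage1 m) *
        ((6 * l ^ 2) ^ 4 * 2 / ((m : ℝ) + 1) / ((m : ℝ) + 1)) := by
  set q : ℝ := (6 * l ^ 2) ^ 4 * 2 / ((m : ℝ) + 1) with hqdef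
  set S := Finset.univ.filter (fun z : Stage1 m => (reachSet z v).card < M) with hS
  set F := S.image (fun z => reachSet z v) with hF
  have hm' : (1 : ℝ) ≤ m := by exact_mod_cast hm
  have h1 : S.card = ∑ T ∈ F, (S.filter (fun z => reachSet z v = T)).card :=
    Finset.card_eq_sum_card_image _ _
  have h2 : ∀ T ∈ F, ((S.filter (fun z => reachSet z v = T)).card : ℝ) ≤
      Fintype.card (Stage1 m) * (q / ((m : ℝ) + 1)) *
        ((1 / (((m + 1 : ℕ) : ℝ) + 1)) ^ (T.card - 1) * (1 / 3 : ℝ) ^ T.card) := by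
    intro T hT
    obtain ⟨z, hz, rfl⟩ := Finset.mem_image.1 hT
    set T := reachSet z v with hTdef
    have hsub : S.filter (fun z => reachSet z v = T)
        ⊆ Finset.univ.filter (fun z : Stage1 m => StepClosed z T) := by
      intro y hy
      rw [Finset.mem_filter] at hy ⊢
      exact ⟨Finset.mem_univ _, hy.2 ▸ stepClosed_reachSet y v⟩
    have hTM : T.card < M := (Finset.mem_filter.1 hz).2
    have hTpos : 1 ≤ T.card := Finset.card_pos.2 ⟨v, mem_reachSet_self z v⟩
    have hlog : Real.logb 2 T.card ≤ l := by
      refine le_trans ?_ hM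
      exact Real.logb_le_logb_of_le (by norm_num) (by exact_mod_cast hTpos)
        (by exact_mod_cast hTM.le)
    refine (Nat.cast_le.2 (Finset.card_le_card hsub)).trans ?_
    refine (card_stepClosed_le hm T).trans ?_
    rw [mul_assoc]
    gcongr
    refine (prod_weight_le hm T (by linarith) hlog).trans ?_
    have hodd : 1 ≤ (T.filter OddVtx).card := card_odd_reachSet_pos z v
    have h4 : T.card ≤ 4 * (T.filter OddVtx).card := card_reachSet_le z v
    set a := T.card
    set o := (T.filter OddVtx).card
    have hkey : (6 * l ^ 2) ^ a * (2 / ((m : ℝ) + 1)) ^ o ≤ q := by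
      calc (6 * l ^ 2) ^ a * (2 / ((m : ℝ) + 1)) ^ o
          ≤ (6 * l ^ 2) ^ (4 * o) * (2 / ((m : ℝ) + 1)) ^ o := by
            gcongr
            nlinarith
        _ = q ^ o := by rw [pow_mul, ← mul_pow, hqdef, mul_div_assoc]
        _ ≤ q ^ 1 := pow_le_pow_of_le_one (by positivity) hq hodd
        _ = q := pow_one q
    obtain ⟨b, hb⟩ : ∃ b, a = b + 1 := ⟨a - 1, by omega⟩
    have h2n : (2 * ((m : ℝ) + 1))⁻¹ ^ b ≤ (1 / (((m + 1 : ℕ) : ℝ) + 1)) ^ b := by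
      rw [one_div]
      gcongr
      push_cast
      linarith
    calc (l ^ 2 / ((m : ℝ) + 1)) ^ a * (2 / ((m : ℝ) + 1)) ^ o
        = ((6 * l ^ 2) ^ a * (2 / ((m : ℝ) + 1)) ^ o) * (1 / (6 * ((m : ℝ) + 1))) ^ a := by
          rw [mul_right_comm, ← mul_pow]
          congr 2
          field_simp
      _ ≤ q * (1 / (6 * ((m : ℝ) + 1))) ^ a := by gcongr
      _ = q / ((m : ℝ) + 1) * ((2 * ((m : ℝ) + 1))⁻¹ ^ b * (1 / 3 : ℝ) ^ a) / 2 := by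
          rw [hb, pow_succ, pow_succ]
          have : (1 / (6 * ((m : ℝ) + 1))) = (2 * ((m : ℝ) + 1))⁻¹ * (1 / 3) := by
            rw [mul_inv, one_div, mul_inv]; ring
          rw [this, mul_pow, mul_inv]
          ring
      _ ≤ q / ((m : ℝ) + 1) * ((2 * ((m : ℝ) + 1))⁻¹ ^ b * (1 / 3 : ℝ) ^ a) :=
          half_le_self (by positivity)
      _ ≤ _ := by
          rw [hb, Nat.add_sub_cancel]
          gcongr
  rw [h1, Nat.cast_sum]
  refine (Finset.sum_le_sum h2).trans ?_
  rw [← Finset.mul_sum]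
  refine mul_le_of_le_one_right (by positivity) (sum_connectedFrom_le v F ?_)
  intro T hT
  obtain ⟨z, _, rfl⟩ := Finset.mem_image.1 hT
  exact connectedFrom_reachSet z v

/-- `A` is a union of connected components of the graph revealed first. -/
def StepUnion {m : ℕ} (z : Stage1 m) (A : Finset (Vtx (m + 1))) : Prop :=
  ∀ u w, Step z u w → (u ∈ A ↔ w ∈ A)

/-- No second choice of an even vertex, given by `h`, crosses the boundary of `A`. -/
def NoCross {m : ℕ} (z : Stage1 m) (h : Vtx (m + 1) → Fin m) (A : Finset (Vtx (m + 1))) : Prop :=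
  ∀ v, ¬ OddVtx v → (v ∈ A ↔ flipBit v ((z v).1.succAbove (h v)) ∈ A)

/-- The directions in which the edge at `v` crosses the boundary of `A`. -/
def crossDirs {n : ℕ} (A : Finset (Vtx n)) (v : Vtx n) : Finset (Fin n) :=
  Finset.univ.filter (fun i => ¬ (v ∈ A ↔ flipBit v i ∈ A))

lemma card_succAbove_notMem_le {m : ℕ} (D : Finset (Fin (m + 1))) {i : Fin (m + 1)} (hi : i ∉ D) :
    ((Finset.univ.filter (fun r : Fin m => i.succAbove r ∉ D)).card : ℝ)
      ≤ m * Real.exp (-((D.card : ℝ) / ((m : ℝ) + 1))) := by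
  have h1 : D.card ≤ (Finset.univ.filter (fun r : Fin m => i.succAbove r ∈ D)).card := by
    have : D ⊆ (Finset.univ.filter (fun r : Fin m => i.succAbove r ∈ D)).image i.succAbove := by
      intro j hj
      obtain ⟨r, rfl⟩ := Fin.exists_succAbove_eq (x := j) (y := i) (fun h => hi (h ▸ hj))
      exact Finset.mem_image.2 ⟨r, by simpa using hj, rfl⟩
    exact (Finset.card_le_card this).trans Finset.card_image_le
  have h2 := Finset.card_filter_add_card_filter_not (s := (Finset.univ : Finset (Fin m)))
    (fun r : Fin m => i.succAbove r ∈ D)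
  rw [Finset.card_univ, Fintype.card_fin] at h2
  have h3 : ((Finset.univ.filter (fun r : Fin m => i.succAbove r ∉ D)).card : ℝ) + D.card ≤ m := by
    exact_mod_cast (by omega : (Finset.univ.filter (fun r : Fin m => i.succAbove r ∉ D)).card
      + D.card ≤ m)
  have h4 := Real.add_one_le_exp (-((D.card : ℝ) / ((m : ℝ) + 1)))
  have h5 : (m : ℝ) * ((D.card : ℝ) / ((m : ℝ) + 1)) ≤ D.card := by
    rw [mul_div_assoc', div_le_iff₀ (by positivity)]
    nlinarith [(Nat.cast_nonneg D.card : (0 : ℝ) ≤ D.card)]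
  have h6 := mul_le_mul_of_nonneg_left h4 (Nat.cast_nonneg m : (0 : ℝ) ≤ m)
  nlinarith

lemma card_noCross_le {m : ℕ} (z : Stage1 m) (A : Finset (Vtx (m + 1))) (hA : StepUnion z A) :
    ((Finset.univ.filter (fun h : Vtx (m + 1) → Fin m => NoCross z h A)).card : ℝ)
      ≤ Fintype.card (Vtx (m + 1) → Fin m) *
        Real.exp (-((∑ v with ¬ OddVtx v, (crossDirs A v).card : ℕ) / ((m : ℝ) + 1))) := by
  set t : Vtx (m + 1) → Finset (Fin m) := fun v =>
    if ¬ OddVtx v then Finset.univ.filter (fun r : Fin m => (z v).1.succAbove r ∉ crossDirs A v)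
    else Finset.univ with ht
  have hsub : Finset.univ.filter (fun h : Vtx (m + 1) → Fin m => NoCross z h A)
      ⊆ Fintype.piFinset t := by
    intro h hh
    rw [Finset.mem_filter] at hh
    rw [Fintype.mem_piFinset]
    intro v
    by_cases hv : ¬ OddVtx v
    · have := hh.2 v hv
      simp only [ht, if_pos hv, Finset.mem_filter, Finset.mem_univ, true_and, crossDirs, not_not]
      exact this
    · simp only [ht, if_neg hv, Finset.mem_univ]
  have hcard : ∀ v, ((t v).card : ℝ) ≤ m *
      (if ¬ OddVtx v then Real.exp (-(((crossDirs A v).card : ℝ) / ((m : ℝ) + 1))) else 1) := by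
    intro v
    by_cases hv : ¬ OddVtx v
    · simp only [ht, if_pos hv]
      refine card_succAbove_notMem_le _ ?_
      simp only [crossDirs, Finset.mem_filter, Finset.mem_univ, true_and, not_not]
      exact hA v _ (Or.inl rfl)
    · simp only [ht, if_neg hv, Finset.card_univ, Fintype.card_fin, mul_one, le_refl]
  refine (Nat.cast_le.2 (Finset.card_le_card hsub)).trans ?_
  rw [Fintype.card_piFinset, Nat.cast_prod]
  refine (Finset.prod_le_prod (fun _ _ => by positivity) (fun v _ => hcard v)).trans (le_of_eq ?_)
  rw [Finset.prod_mul_distrib, Finset.prod_const, Finset.card_univ, ← Finset.prod_filter,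
    ← Real.exp_sum, Finset.sum_neg_distrib, ← Finset.sum_div, Fintype.card_fun]
  simp

lemma card_vtx (n : ℕ) : Fintype.card (Vtx n) = 2 ^ n := by simp

/-- A set containing at most half of the cube has at least as many boundary edges as vertices. -/
lemma card_le_sum_crossDirs {n : ℕ} (A : Finset (Vtx n)) (hA : 2 * A.card ≤ 2 ^ n) :
    A.card ≤ ∑ v ∈ A, (crossDirs A v).card := by
  rcases Nat.eq_zero_or_pos A.card with h0 | hpos
  · rw [h0]; exact Nat.zero_le _
  have h1 : ∀ v ∈ A, ((crossDirs A v).card : ℝ) = n - (dirsInto A v).card := by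
    intro v hv
    have := Finset.card_filter_add_card_filter_not (s := (Finset.univ : Finset (Fin n)))
      (fun i => flipBit v i ∈ A)
    have e : crossDirs A v = Finset.univ.filter (fun i => ¬ flipBit v i ∈ A) := by
      unfold crossDirs
      simp [hv]
    rw [Finset.card_univ, Fintype.card_fin, ← e] at this
    rw [eq_sub_iff_add_eq', dirsInto]
    exact_mod_cast this
  have h2 := sum_card_dirsInto_le A
  have h3 : Real.logb 2 A.card ≤ n - 1 := by
    have h4 : Real.logb 2 (2 * A.card) ≤ Real.logb 2 (2 ^ n) :=
      Real.logb_le_logb_of_le (by norm_num) (by positivity) (by exact_mod_cast hA)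
    rw [Real.logb_mul (by norm_num) (by positivity), Real.logb_self_eq_one (by norm_num),
      Real.logb_pow, Real.logb_self_eq_one (by norm_num)] at h4
    linarith
  have h5 : (A.card : ℝ) ≤ ∑ v ∈ A, ((crossDirs A v).card : ℝ) := by
    rw [Finset.sum_congr rfl h1, Finset.sum_sub_distrib, Finset.sum_const, nsmul_eq_mul]
    have : (0 : ℝ) < A.card := by exact_mod_cast hpos
    nlinarith
  exact_mod_cast h5

lemma sum_crossDirs_le_sum_even {n : ℕ} (A : Finset (Vtx n)) :
    ∑ v ∈ A, (crossDirs A v).card ≤ ∑ v with ¬ OddVtx v, (crossDirs A v).card := by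
  rw [← Finset.card_sigma, ← Finset.card_sigma]
  refine Finset.card_le_card_of_injOn
    (fun p : (_ : Vtx n) × Fin n =>
      if OddVtx p.1 then (⟨flipBit p.1 p.2, p.2⟩ : (_ : Vtx n) × Fin n) else p) ?_ ?_
  · rintro ⟨v, i⟩ hp
    simp only [Finset.mem_coe, Finset.mem_sigma, crossDirs, Finset.mem_filter, Finset.mem_univ,
      true_and] at hp
    by_cases hv : OddVtx v
    · simp only [if_pos hv, Finset.mem_coe, Finset.mem_sigma, crossDirs, Finset.mem_filter,
        Finset.mem_univ, true_and, oddVtx_flipBit, flipBit_flipBit]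
      tauto
    · simp only [if_neg hv, Finset.mem_coe, Finset.mem_sigma, crossDirs, Finset.mem_filter,
        Finset.mem_univ, true_and]
      tauto
  · rintro ⟨v, i⟩ hp ⟨w, j⟩ hq h
    simp only [Finset.mem_coe, Finset.mem_sigma, crossDirs, Finset.mem_filter, Finset.mem_univ,
      true_and] at hp hq
    by_cases hv : OddVtx v <;> by_cases hw : OddVtx w <;>
      simp only [if_pos, if_neg, hv, hw, not_false_eq_true, Sigma.mk.injEq] at h
    · obtain ⟨h1, h2⟩ := h
      obtain rfl := eq_of_heq h2
      obtain rfl := flipBit_left_injective i h1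
      rfl
    · obtain ⟨h1, h2⟩ := h
      subst h1
      exact absurd hq.1 (by tauto)
    · obtain ⟨h1, h2⟩ := h
      subst h1
      exact absurd hp.1 (by tauto)
    · simpa using h

lemma card_noCross_le_exp {m : ℕ} (z : Stage1 m) (A : Finset (Vtx (m + 1))) (hA : StepUnion z A)
    (hhalf : 2 * A.card ≤ 2 ^ (m + 1)) :
    ((Finset.univ.filter (fun h : Vtx (m + 1) → Fin m => NoCross z h A)).card : ℝ)
      ≤ Fintype.card (Vtx (m + 1) → Fin m) * Real.exp (-((A.card : ℝ) / ((m : ℝ) + 1))) := by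
  refine (card_noCross_le z A hA).trans ?_
  gcongr
  exact (card_le_sum_crossDirs A hhalf).trans (sum_crossDirs_le_sum_even A)

/-- The vertices with few reachable vertices. -/
def smallSet {m : ℕ} (M : ℕ) (z : Stage1 m) : Finset (Vtx (m + 1)) :=
  Finset.univ.filter (fun v => (reachSet z v).card < M)

lemma card_stepUnion_le {m : ℕ} (z : Stage1 m) {M : ℕ} (hM : 0 < M) :
    ((Finset.univ.filter (fun A : Finset (Vtx (m + 1)) => StepUnion z A)).card : ℝ)
      ≤ (2 : ℝ) ^ (((smallSet M z).card : ℝ) + (2 : ℝ) ^ (m + 1) / M) := by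
  set H : SimpleGraph (Vtx (m + 1)) := SimpleGraph.fromRel (Step z) with hH
  have hadj : ∀ u w, Step z u w → H.connectedComponentMk u = H.connectedComponentMk w := by
    intro u w h
    rw [SimpleGraph.ConnectedComponent.eq]
    refine SimpleGraph.Adj.reachable ?_
    rw [hH, SimpleGraph.fromRel_adj]
    refine ⟨?_, Or.inl h⟩
    obtain ⟨i, rfl⟩ := h.exists_flipBit
    exact (flipBit_ne u i).symm
  have hunion : ∀ A, StepUnion z A → ∀ u w, H.Reachable u w → (u ∈ A ↔ w ∈ A) := by
    intro A hA u w h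
    obtain ⟨p⟩ := h
    induction p with
    | nil => rfl
    | cons h _ ih =>
      rw [← ih]
      rw [hH, SimpleGraph.fromRel_adj] at h
      rcases h.2 with h | h
      · exact hA _ _ h
      · exact (hA _ _ h).symm
  have hcount : (Finset.univ.filter (fun A : Finset (Vtx (m + 1)) => StepUnion z A)).card
      ≤ 2 ^ Fintype.card H.ConnectedComponent := by
    rw [← Fintype.card_finset, ← Finset.card_univ]
    refine Finset.card_le_card_of_injOn (fun A => A.image H.connectedComponentMk)
      (fun _ _ => Finset.mem_coe.2 (Finset.mem_univ _)) ?_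
    intro A hA B hB hAB
    have hmem : ∀ C, StepUnion z C → ∀ v, v ∈ C ↔
        H.connectedComponentMk v ∈ C.image H.connectedComponentMk := by
      intro C hC v
      refine ⟨Finset.mem_image_of_mem _, fun h => ?_⟩
      obtain ⟨w, hw, hwv⟩ := Finset.mem_image.1 h
      exact (hunion C hC w v (SimpleGraph.ConnectedComponent.eq.1 hwv)).1 hw
    simp only [Finset.coe_filter, Finset.mem_univ, true_and, Set.mem_ofPred_eq] at hA hB
    ext v
    have hAB' : A.image H.connectedComponentMk = B.image H.connectedComponentMk := hAB
    rw [hmem A hA, hmem B hB, hAB']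
  set I := (smallSet M z).image H.connectedComponentMk with hI
  have hIcard : I.card ≤ (smallSet M z).card := Finset.card_image_le
  have hgood : M * Iᶜ.card ≤ 2 ^ (m + 1) := by
    rw [← card_vtx, ← Finset.card_univ, mul_comm]
    have h1 := (Finset.sum_card_fiberwise_eq_card_filter
      (Finset.univ : Finset (Vtx (m + 1))) Iᶜ H.connectedComponentMk).trans_le
        (Finset.card_filter_le _ _)
    refine le_trans ?_ h1
    rw [← smul_eq_mul]
    refine Finset.card_nsmul_le_sum _ _ _ fun C hC => ?_
    induction C using SimpleGraph.ConnectedComponent.ind with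
    | h v =>
      have hv : v ∉ smallSet M z := fun h =>
        Finset.mem_compl.1 hC (Finset.mem_image_of_mem _ h)
      have hv' : M ≤ (reachSet z v).card := by simpa [smallSet] using hv
      refine hv'.trans (Finset.card_le_card fun w hw => ?_)
      simp only [reachSet, Finset.mem_filter, Finset.mem_univ, true_and] at hw ⊢
      induction hw with
      | refl => rfl
      | tail _ hbc ih => rw [← ih, hadj _ _ hbc]
  have hK : (Fintype.card H.ConnectedComponent : ℝ)
      ≤ ((smallSet M z).card : ℝ) + (2 : ℝ) ^ (m + 1) / M := by
    have h1 : Fintype.card H.ConnectedComponent = I.card + Iᶜ.card :=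
      (Finset.card_add_card_compl I).symm
    have h2 : (Iᶜ.card : ℝ) ≤ (2 : ℝ) ^ (m + 1) / M := by
      rw [le_div_iff₀ (by exact_mod_cast hM), mul_comm]
      exact_mod_cast hgood
    have h3 : (I.card : ℝ) ≤ (smallSet M z).card := by exact_mod_cast hIcard
    rw [h1]
    push_cast
    linarith
  calc ((Finset.univ.filter (fun A : Finset (Vtx (m + 1)) => StepUnion z A)).card : ℝ)
      ≤ (2 : ℝ) ^ Fintype.card H.ConnectedComponent := by exact_mod_cast hcount
    _ = (2 : ℝ) ^ (Fintype.card H.ConnectedComponent : ℝ) := (Real.rpow_natCast _ _).symm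
    _ ≤ _ := Real.rpow_le_rpow_of_exponent_le (by norm_num) hK

/-- The graph revealed in two stages has a union of components of size between `e` and half of
the cube. -/
def BadCut {m : ℕ} (e : ℝ) (z : Stage1 m) (h : Vtx (m + 1) → Fin m) : Prop :=
  ∃ A : Finset (Vtx (m + 1)), StepUnion z A ∧ NoCross z h A ∧ e ≤ A.card ∧
    2 * A.card ≤ 2 ^ (m + 1)

lemma card_badCut_le {m : ℕ} (e : ℝ) (z : Stage1 m) {M : ℕ} (hM : 0 < M) :
    ((Finset.univ.filter (fun h : Vtx (m + 1) → Fin m => BadCut e z h)).card : ℝ)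
      ≤ Fintype.card (Vtx (m + 1) → Fin m) *
        ((2 : ℝ) ^ (((smallSet M z).card : ℝ) + (2 : ℝ) ^ (m + 1) / M) *
          Real.exp (-(e / ((m : ℝ) + 1)))) := by
  set F := Finset.univ.filter (fun A : Finset (Vtx (m + 1)) =>
    StepUnion z A ∧ e ≤ A.card ∧ 2 * A.card ≤ 2 ^ (m + 1)) with hF
  have hsub : Finset.univ.filter (fun h : Vtx (m + 1) → Fin m => BadCut e z h) ⊆
      F.biUnion (fun A => Finset.univ.filter (fun h => NoCross z h A)) := by
    intro h hh
    obtain ⟨A, h1, h2, h3, h4⟩ := (Finset.mem_filter.1 hh).2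
    simp only [Finset.mem_biUnion, Finset.mem_filter, Finset.mem_univ, true_and, hF]
    exact ⟨A, ⟨h1, h3, h4⟩, h2⟩
  have hle := (Finset.card_le_card hsub).trans Finset.card_biUnion_le
  have hle' : ((Finset.univ.filter (fun h : Vtx (m + 1) → Fin m => BadCut e z h)).card : ℝ)
      ≤ ∑ A ∈ F, ((Finset.univ.filter (fun h => NoCross z h A)).card : ℝ) := by
    exact_mod_cast hle
  refine hle'.trans ?_
  have hterm : ∀ A ∈ F, ((Finset.univ.filter (fun h => NoCross z h A)).card : ℝ)
      ≤ Fintype.card (Vtx (m + 1) → Fin m) * Real.exp (-(e / ((m : ℝ) + 1))) := by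
    intro A hA
    simp only [hF, Finset.mem_filter, Finset.mem_univ, true_and] at hA
    refine (card_noCross_le_exp z A hA.1 hA.2.2).trans ?_
    gcongr
    exact hA.2.1
  refine (Finset.sum_le_sum hterm).trans ?_
  rw [Finset.sum_const, nsmul_eq_mul, mul_left_comm]
  gcongr
  refine le_trans ?_ (card_stepUnion_le z hM)
  exact_mod_cast Finset.card_le_card fun A hA => by
    simp only [hF, Finset.mem_filter, Finset.mem_univ, true_and] at hA ⊢
    exact hA.1

/-- The proportion of outcomes of the two stages with a bad cut is small. -/
lemma card_badCut_prod_le {m : ℕ} (hm : 1 ≤ m) (e : ℝ) {M : ℕ} (hM : 0 < M) {l : ℝ} (hl : 1 ≤ l)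
    (hMl : Real.logb 2 M ≤ l) {q : ℝ} (hq : q = (6 * l ^ 2) ^ 4 * 2 / ((m : ℝ) + 1))
    (hq1 : q ≤ 1) :
    ((Finset.univ.filter (fun p : Stage1 m × (Vtx (m + 1) → Fin m) =>
        BadCut e p.1 p.2)).card : ℝ)
      ≤ Fintype.card (Stage1 m × (Vtx (m + 1) → Fin m)) *
        (√q + (2 : ℝ) ^ (√q * 2 ^ (m + 1) / ((m : ℝ) + 1) + (2 : ℝ) ^ (m + 1) / M) *
          Real.exp (-(e / ((m : ℝ) + 1)))) := by
  have hq0 : 0 < q := by rw [hq]; positivity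
  set N : ℝ := 2 ^ (m + 1) with hN
  have hNpos : 0 < N := by positivity
  set β : ℝ := √q * N / ((m : ℝ) + 1) with hβ
  have hβpos : 0 < β := by positivity
  set W : ℝ := (2 : ℝ) ^ (β + N / M) * Real.exp (-(e / ((m : ℝ) + 1))) with hW
  have hW0 : 0 ≤ W := by positivity
  set S1 : ℝ := (Fintype.card (Stage1 m) : ℝ) with hS1
  set S2 : ℝ := (Fintype.card (Vtx (m + 1) → Fin m) : ℝ) with hS2
  have hsum : ∑ z : Stage1 m, ((smallSet M z).card : ℝ) ≤ N * (S1 * (q / ((m : ℝ) + 1))) := by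
    have h1 : ∑ z : Stage1 m, ((smallSet M z).card : ℝ)
        = ∑ v : Vtx (m + 1), ((Finset.univ.filter
            (fun z : Stage1 m => (reachSet z v).card < M)).card : ℝ) := by
      simp only [smallSet, Finset.card_filter, Nat.cast_sum]
      exact Finset.sum_comm
    rw [h1]
    have h2 := Finset.sum_le_card_nsmul (Finset.univ : Finset (Vtx (m + 1)))
      (fun v => ((Finset.univ.filter (fun z : Stage1 m => (reachSet z v).card < M)).card : ℝ))
      (S1 * (q / ((m : ℝ) + 1)))
      (fun v _ => by rw [hq]; exact card_small_reachSet_le hm v M hl hMl (hq ▸ hq1))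
    rw [Finset.card_univ, card_vtx, nsmul_eq_mul] at h2
    rw [hN]
    exact_mod_cast h2
  have hmarkov : ((Finset.univ.filter (fun z : Stage1 m => β < (smallSet M z).card)).card : ℝ)
      ≤ S1 * √q := by
    have h1 : ((Finset.univ.filter (fun z : Stage1 m => β < (smallSet M z).card)).card : ℝ) * β
        ≤ ∑ z : Stage1 m, ((smallSet M z).card : ℝ) := by
      rw [← nsmul_eq_mul]
      refine (Finset.card_nsmul_le_sum _ (fun z : Stage1 m => ((smallSet M z).card : ℝ)) β
        fun z hz => (Finset.mem_filter.1 hz).2.le).trans ?_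
      exact Finset.sum_le_sum_of_subset_of_nonneg (Finset.filter_subset _ _)
        fun _ _ _ => by positivity
    have h2 : N * (S1 * (q / ((m : ℝ) + 1))) = S1 * √q * β := by
      rw [hβ]
      nth_rewrite 1 [← Real.mul_self_sqrt hq0.le]
      ring
    exact le_of_mul_le_mul_right ((h1.trans hsum).trans_eq h2) hβpos
  have hfib : ((Finset.univ.filter (fun p : Stage1 m × (Vtx (m + 1) → Fin m) =>
        BadCut e p.1 p.2)).card : ℝ)
      = ∑ z : Stage1 m, ((Finset.univ.filter
          (fun h : Vtx (m + 1) → Fin m => BadCut e z h)).card : ℝ) := by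
    simp only [Finset.card_filter, Nat.cast_sum, ← Finset.univ_product_univ, Finset.sum_product]
  rw [hfib]
  have hz : ∀ z : Stage1 m, ((Finset.univ.filter
      (fun h : Vtx (m + 1) → Fin m => BadCut e z h)).card : ℝ)
        ≤ (if β < (smallSet M z).card then S2 else 0) + S2 * W := by
    intro z
    split_ifs with hc
    · have : ((Finset.univ.filter (fun h : Vtx (m + 1) → Fin m => BadCut e z h)).card : ℝ)
          ≤ S2 := by
        rw [hS2, ← Finset.card_univ]
        exact_mod_cast Finset.card_filter_le _ _
      have : 0 ≤ S2 * W := by positivity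
      linarith
    · rw [zero_add]
      refine (card_badCut_le e z hM).trans ?_
      rw [hW]
      gcongr
      · norm_num
      · exact not_lt.1 hc
  refine (Finset.sum_le_sum fun z _ => hz z).trans ?_
  rw [Finset.sum_add_distrib, ← Finset.sum_filter, Finset.sum_const, Finset.sum_const,
    nsmul_eq_mul, nsmul_eq_mul, Finset.card_univ, Fintype.card_prod]
  push_cast
  have := mul_le_mul_of_nonneg_right hmarkov (show 0 ≤ S2 by positivity)
  change _ * S2 + S1 * (S2 * W) ≤ S1 * S2 * (√q + W)
  linarith

lemma exists_large_component {V : Type*} [Fintype V] (G : SimpleGraph V) (e : ℝ) (he : 0 < e)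
    (h4 : 4 * e ≤ Fintype.card V)
    (hno : ∀ A : Finset V, (∀ u w, G.Adj u w → (u ∈ A ↔ w ∈ A)) → e ≤ A.card →
      ¬ 2 * A.card ≤ Fintype.card V) :
    ∃ v, (Fintype.card V : ℝ) - e ≤ (compSize G v : ℝ) := by
  set F := (Finset.univ : Finset (Finset V)).filter
    (fun A => (∀ u w, G.Adj u w → (u ∈ A ↔ w ∈ A)) ∧ e ≤ A.card) with hF
  have hFne : F.Nonempty := by
    refine ⟨Finset.univ, ?_⟩
    simp only [hF, Finset.mem_filter, Finset.mem_univ, true_and, Finset.card_univ, implies_true,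
      true_and]
    linarith
  obtain ⟨A, hAF, hmin⟩ := Finset.exists_min_image F Finset.card hFne
  simp only [hF, Finset.mem_filter, Finset.mem_univ, true_and] at hAF
  have hApos : (0 : ℝ) < A.card := he.trans_le hAF.2
  obtain ⟨v, hv⟩ := Finset.card_pos.1 (by exact_mod_cast hApos : 0 < A.card)
  refine ⟨v, ?_⟩
  set C := Finset.univ.filter (fun w => G.Reachable v w) with hC
  have hcomp : compSize G v = C.card := by
    rw [compSize, Nat.card_eq_fintype_card, Fintype.card_subtype]
  rw [hcomp]
  have hCadj : ∀ u w, G.Adj u w → (u ∈ C ↔ w ∈ C) := by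
    intro u w huw
    simp only [hC, Finset.mem_filter, Finset.mem_univ, true_and]
    exact ⟨fun h => h.trans huw.reachable, fun h => h.trans huw.symm.reachable⟩
  have hvC : v ∈ C := by simp [hC]
  have hcompl : C.card + Cᶜ.card = Fintype.card V := Finset.card_add_card_compl C
  have hcompl' : (C.card : ℝ) + Cᶜ.card = Fintype.card V := by exact_mod_cast hcompl
  by_cases hCe : e ≤ C.card
  · by_contra hlt
    have h1 : e ≤ Cᶜ.card := by linarith
    have h2 := hno C hCadj hCe
    have h3 := hno Cᶜ (fun u w huw => by
      rw [Finset.mem_compl, Finset.mem_compl, hCadj u w huw]) h1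
    omega
  · exfalso
    have h1 : ((A \ C).card : ℝ) < e := by
      by_contra hge
      have hmem : A \ C ∈ F := by
        simp only [hF, Finset.mem_filter, Finset.mem_univ, true_and]
        refine ⟨fun u w huw => ?_, not_lt.1 hge⟩
        rw [Finset.mem_sdiff, Finset.mem_sdiff, hCadj u w huw, hAF.1 u w huw]
      have h2 := hmin _ hmem
      have h3 : (A \ C).card < A.card := by
        refine Finset.card_lt_card (Finset.ssubset_iff_subset_ne.2 ⟨Finset.sdiff_subset, ?_⟩)
        intro h
        have := h ▸ hv
        exact (Finset.mem_sdiff.1 this).2 hvC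
      omega
    have h2 : (A.card : ℝ) ≤ (A \ C).card + C.card := by
      exact_mod_cast (Finset.card_le_card_sdiff_add_card (s := A) (t := C))
    refine hno A hAF.1 hAF.2 ?_
    have h3 : 2 * (A.card : ℝ) ≤ Fintype.card V := by linarith [not_le.1 hCe]
    exact_mod_cast h3

/-- The two neighbours of `v` selected by a first direction and an index for the second one. -/
def pick {m : ℕ} (v : Vtx (m + 1)) (p : Fin (m + 1) × Fin m) :
    {s : Finset (Vtx (m + 1)) // s.card = 2 ∧ ∀ u ∈ s, (cubeGraph (m + 1)).Adj v u} :=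
  ⟨{flipBit v p.1, flipBit v (p.1.succAbove p.2)}, by
    refine ⟨Finset.card_pair fun h => ?_, fun u hu => ?_⟩
    · exact Fin.succAbove_ne p.1 p.2 (flipBit_right_injective v h).symm
    · rw [cubeGraph_adj_iff]
      rw [Finset.mem_insert, Finset.mem_singleton] at hu
      rcases hu with h | h
      · exact ⟨_, h⟩
      · exact ⟨_, h⟩⟩

lemma card_pick_fiber {m : ℕ} (v : Vtx (m + 1))
    (y : {s : Finset (Vtx (m + 1)) // s.card = 2 ∧ ∀ u ∈ s, (cubeGraph (m + 1)).Adj v u}) :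
    (Finset.univ.filter (fun p => pick v p = y)).card = 2 := by
  obtain ⟨s, hs, hadj⟩ := y
  obtain ⟨a, b, hab, rfl⟩ := Finset.card_eq_two.1 hs
  obtain ⟨i, rfl⟩ := (cubeGraph_adj_iff _ _).1 (hadj a (by simp))
  obtain ⟨j, rfl⟩ := (cubeGraph_adj_iff _ _).1 (hadj b (by simp))
  have hij : i ≠ j := fun h => hab (h ▸ rfl)
  obtain ⟨r, hr⟩ := Fin.exists_succAbove_eq hij.symm
  obtain ⟨t, ht⟩ := Fin.exists_succAbove_eq hij
  rw [Finset.card_eq_two]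
  refine ⟨(i, r), (j, t), fun h => hij (congrArg Prod.fst h), ?_⟩
  ext ⟨k, u⟩
  simp only [Finset.mem_filter, Finset.mem_univ, true_and, Finset.mem_insert,
    Finset.mem_singleton, pick, Subtype.mk.injEq, Prod.mk.injEq]
  constructor
  · intro h
    have h1 : flipBit v k ∈ ({flipBit v i, flipBit v j} : Finset (Vtx (m + 1))) := by
      rw [← h]; simp
    have h2 : flipBit v (k.succAbove u) ∈ ({flipBit v i, flipBit v j} : Finset (Vtx (m + 1))) := by
      rw [← h]; simp
    simp only [Finset.mem_insert, Finset.mem_singleton, (flipBit_right_injective v).eq_iff] at h1 h2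
    have hne := Fin.succAbove_ne k u
    rcases h1 with rfl | rfl
    · refine Or.inl ⟨rfl, ?_⟩
      have : k.succAbove u = k.succAbove r := by rw [hr]; tauto
      exact Fin.succAbove_right_injective this
    · refine Or.inr ⟨rfl, ?_⟩
      have : k.succAbove u = k.succAbove t := by rw [ht]; tauto
      exact Fin.succAbove_right_injective this
  · rintro (⟨rfl, rfl⟩ | ⟨rfl, rfl⟩)
    · rw [hr]
    · rw [ht, Finset.pair_comm]

/-- The choice at `v` given the direction and second index revealed first, and the second index
revealed last, which is the one used at even vertices. -/
def pickTwoStage {m : ℕ} (v : Vtx (m + 1)) (x : (Fin (m + 1) × Fin m) × Fin m) :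
    {s : Finset (Vtx (m + 1)) // s.card = 2 ∧ ∀ u ∈ s, (cubeGraph (m + 1)).Adj v u} :=
  if OddVtx v then pick v x.1 else pick v (x.1.1, x.2)

lemma card_pickTwoStage_fiber {m : ℕ} (v : Vtx (m + 1))
    (y : {s : Finset (Vtx (m + 1)) // s.card = 2 ∧ ∀ u ∈ s, (cubeGraph (m + 1)).Adj v u}) :
    (Finset.univ.filter (fun x => pickTwoStage v x = y)).card = 2 * m := by
  have h1 : ((Finset.univ.filter (fun p => pick v p = y)) ×ˢ
      (Finset.univ : Finset (Fin m))).card = 2 * m := by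
    rw [Finset.card_product, card_pick_fiber, Finset.card_univ, Fintype.card_fin]
  rw [← h1]
  by_cases hv : OddVtx v
  · congr 1
    ext x
    simp [pickTwoStage, hv]
  · refine Finset.card_bij' (fun x _ => ((x.1.1, x.2), x.1.2)) (fun x _ => ((x.1.1, x.2), x.1.2))
      ?_ ?_ ?_ ?_
    · intro x hx
      simpa [pickTwoStage, hv] using hx
    · intro x hx
      simpa [pickTwoStage, hv] using hx
    · intro x _; rfl
    · intro x _; rfl

lemma card_pi_fiber {V X : Type*} [Fintype V] [DecidableEq V] [Fintype X]
    {Y : V → Type*} [∀ v, Fintype (Y v)]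
    (f : ∀ v, X → Y v) (c : ℕ)
    (hc : ∀ v y, (Finset.univ.filter (fun x => f v x = y)).card = c) (P : (∀ v, Y v) → Prop) :
    (Finset.univ.filter (fun x : V → X => P (fun v => f v (x v)))).card
      = c ^ Fintype.card V * (Finset.univ.filter P).card := by
  rw [Finset.card_eq_sum_card_fiberwise (f := fun x v => f v (x v)) (t := Finset.univ.filter P)
    (fun x hx => by simpa using hx)]
  rw [Finset.sum_congr rfl (g := fun _ => c ^ Fintype.card V), Finset.sum_const, smul_eq_mul,
    mul_comm]
  intro y hy
  have : (Finset.univ.filter (fun x : V → X => P (fun v => f v (x v)))).filter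
      (fun x => (fun v => f v (x v)) = y)
      = Fintype.piFinset (fun v => Finset.univ.filter (fun x => f v x = y v)) := by
    ext x
    simp only [Finset.mem_filter, Finset.mem_univ, true_and, Fintype.mem_piFinset]
    constructor
    · rintro ⟨_, rfl⟩ v
      rfl
    · intro h
      have hxy : (fun v => f v (x v)) = y := funext h
      refine ⟨?_, hxy⟩
      rw [hxy]
      exact (Finset.mem_filter.1 hy).2
  rw [this, Fintype.card_piFinset, Finset.prod_congr rfl (fun v _ => hc v (y v)),
    Finset.prod_const, Finset.card_univ]

/-- The outcome of the `2`-out model determined by the two stages. -/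
def twoStage {m : ℕ} (p : Stage1 m × (Vtx (m + 1) → Fin m)) : KOut (m + 1) 2 :=
  fun v => pickTwoStage v (p.1 v, p.2 v)

lemma card_twoStage {m : ℕ} (P : KOut (m + 1) 2 → Prop) :
    (Finset.univ.filter (fun p : Stage1 m × (Vtx (m + 1) → Fin m) => P (twoStage p))).card
      = (2 * m) ^ Fintype.card (Vtx (m + 1)) * (Finset.univ.filter P).card := by
  rw [← card_pi_fiber (fun v => pickTwoStage v) (2 * m)
    (fun v y => by convert card_pickTwoStage_fiber v y) P]
  refine Finset.card_equiv (Equiv.arrowProdEquivProdArrow (Vtx (m + 1))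
    (fun _ => Fin (m + 1) × Fin m) (fun _ => Fin m)).symm fun p => ?_
  simp only [Finset.mem_filter, Finset.mem_univ, true_and]
  rfl

lemma prob_eq {Ω : Type*} [Fintype Ω] (P : Ω → Prop) :
    prob P = ((Finset.univ.filter P).card : ℝ) / Fintype.card Ω := by
  unfold prob
  rw [Nat.card_eq_fintype_card, Nat.card_eq_fintype_card, Fintype.card_subtype]

lemma prob_le_one {Ω : Type*} [Fintype Ω] (P : Ω → Prop) : prob P ≤ 1 := by
  rw [prob_eq]
  refine div_le_one_of_le₀ ?_ (by positivity)
  rw [← Finset.card_univ]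
  exact_mod_cast Finset.card_filter_le _ _

lemma one_sub_le_prob {m : ℕ} (hm : 1 ≤ m) (P : KOut (m + 1) 2 → Prop)
    (B : Stage1 m → (Vtx (m + 1) → Fin m) → Prop) (δ : ℝ)
    (hB : ((Finset.univ.filter (fun p : Stage1 m × (Vtx (m + 1) → Fin m) => B p.1 p.2)).card : ℝ)
      ≤ Fintype.card (Stage1 m × (Vtx (m + 1) → Fin m)) * δ)
    (hP : ∀ z h, ¬ B z h → P (twoStage (z, h))) : 1 - δ ≤ prob P := by
  have hm' : (0 : ℝ) < m := by exact_mod_cast hm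
  set c : ℝ := (2 * m) ^ Fintype.card (Vtx (m + 1)) with hc
  have hcpos : 0 < c := by positivity
  have h1 : (Finset.univ.filter (fun p : Stage1 m × (Vtx (m + 1) → Fin m) =>
      ¬ P (twoStage p))).card
        = (2 * m) ^ Fintype.card (Vtx (m + 1)) * (Finset.univ.filter (fun ω => ¬ P ω)).card := by
    convert card_twoStage (m := m) (fun ω => ¬ P ω)
  have h2 := card_twoStage (m := m) (fun _ => True)
  simp only [Finset.filter_true, Finset.card_univ] at h2
  have h3 : ((Finset.univ.filter (fun p : Stage1 m × (Vtx (m + 1) → Fin m) =>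
      ¬ P (twoStage p))).card : ℝ)
        ≤ ((Finset.univ.filter (fun p : Stage1 m × (Vtx (m + 1) → Fin m) => B p.1 p.2)).card : ℝ) := by
    refine Nat.cast_le.2 (Finset.card_le_card fun p hp => ?_)
    simp only [Finset.mem_filter, Finset.mem_univ, true_and] at hp ⊢
    by_contra hb
    exact hp (hP p.1 p.2 hb)
  have h4 := h3.trans hB
  rw [h1, h2] at h4
  push_cast at h4
  rw [← hc, mul_assoc] at h4
  have h5 := le_of_mul_le_mul_left h4 hcpos
  have hpos : (0 : ℝ) < Fintype.card (KOut (m + 1) 2) := by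
    have : Nonempty (KOut (m + 1) 2) := ⟨fun v => pick v (0, ⟨0, hm⟩)⟩
    exact_mod_cast Fintype.card_pos
  have h6 : ((Finset.univ.filter P).card : ℝ) + (Finset.univ.filter (fun ω => ¬ P ω)).card
      = Fintype.card (KOut (m + 1) 2) := by
    rw [← Finset.card_univ]
    exact_mod_cast Finset.card_filter_add_card_filter_not _
  rw [prob_eq, le_div_iff₀ hpos]
  linarith

lemma mem_twoStage_of_step {m : ℕ} {z : Stage1 m} (h : Vtx (m + 1) → Fin m) {u w : Vtx (m + 1)}
    (hs : Step z u w) : w ∈ (twoStage (z, h) u).1 := by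
  rcases hs with hs | ⟨ho, hs⟩
  · by_cases hu : OddVtx u <;> simp [twoStage, pickTwoStage, pick, hu, hs]
  · simp [twoStage, pickTwoStage, pick, ho, hs]

lemma exists_large_component_of_not_badCut {m : ℕ} {e : ℝ} (he : 0 < e)
    (h4 : 4 * e ≤ 2 ^ (m + 1)) (z : Stage1 m) (h : Vtx (m + 1) → Fin m) (hb : ¬ BadCut e z h) :
    ∃ v, (2 : ℝ) ^ (m + 1) - e ≤ (compSize (kOutGraph (m + 1) 2 (twoStage (z, h))) v : ℝ) := by
  have hN : ((Fintype.card (Vtx (m + 1)) : ℕ) : ℝ) = 2 ^ (m + 1) := by rw [card_vtx]; norm_num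
  rw [← hN] at h4 ⊢
  refine exists_large_component _ e he h4 fun A hA hAe hhalf => hb ⟨A, ?_, ?_, hAe, ?_⟩
  · intro u w hs
    refine hA u w ?_
    rw [kOutGraph, SimpleGraph.fromRel_adj]
    obtain ⟨i, hi⟩ := hs.exists_flipBit
    exact ⟨hi ▸ (flipBit_ne u i).symm, Or.inl (mem_twoStage_of_step h hs)⟩
  · intro v hv
    refine hA _ _ ?_
    rw [kOutGraph, SimpleGraph.fromRel_adj]
    refine ⟨(flipBit_ne _ _).symm, Or.inl ?_⟩
    simp [twoStage, pickTwoStage, pick, hv]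
  · rwa [card_vtx] at hhalf

lemma tendsto_log_pow_mul_div (k : ℕ) (C : ℝ) :
    Tendsto (fun m : ℕ => C * Real.log ((m : ℝ) + 1) ^ k / ((m : ℝ) + 1)) atTop (nhds 0) := by
  have h1 : Tendsto (fun m : ℕ => (m : ℝ) + 1) atTop atTop :=
    tendsto_atTop_add_const_right _ _ tendsto_natCast_atTop_atTop
  have h2 := ((Real.isLittleO_pow_log_id_atTop (n := k)).tendsto_div_nhds_zero.comp h1).const_mul C
  simpa [Function.comp_def, mul_div_assoc] using h2

/-- Twice the binary logarithm of the dimension. -/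
def twiceLog (m : ℕ) : ℝ := 2 * Real.logb 2 ((m : ℝ) + 1)

lemma tendsto_twiceLog : Tendsto twiceLog atTop atTop := by
  have h1 : Tendsto (fun m : ℕ => (m : ℝ) + 1) atTop atTop :=
    tendsto_atTop_add_const_right _ _ tendsto_natCast_atTop_atTop
  exact ((Real.tendsto_logb_atTop one_lt_two).comp h1).const_mul_atTop two_pos

lemma twiceLog_le (m : ℕ) : twiceLog m ≤ 2 * ((m : ℝ) + 1) := by
  have h : Real.logb 2 ((m : ℝ) + 1) ≤ (m : ℝ) + 1 := by
    rw [Real.logb_le_iff_le_rpow one_lt_two (by positivity)]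
    have := one_add_mul_self_le_rpow_one_add (s := 1) (by norm_num) (p := (m : ℝ) + 1)
      (by linarith [(Nat.cast_nonneg m : (0 : ℝ) ≤ m)])
    norm_num at this
    linarith
  unfold twiceLog
  linarith

lemma tendsto_twiceLog_pow_mul_div (k : ℕ) (C : ℝ) :
    Tendsto (fun m : ℕ => C * twiceLog m ^ k / ((m : ℝ) + 1)) atTop (nhds 0) := by
  refine (tendsto_log_pow_mul_div k (C * (2 / Real.log 2) ^ k)).congr fun m => ?_
  rw [twiceLog, Real.logb]
  ring

lemma failure_bound_le {N n l q : ℝ} (hN : 0 < N) (hn : 1 ≤ n) (hl : 1 ≤ l) (hln : l ≤ 2 * n)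
    (hql : 4 * q * l ^ 2 ≤ 1) (hln' : 2 * l / n ≤ 1) :
    √q + (2 : ℝ) ^ (√q * N / n + N / n ^ 2) * Real.exp (-(2 / l * N / n))
      ≤ 1 / (2 * l) + 2 * n ^ 2 / N := by
  have hl0 : 0 < l := by linarith
  have hn0 : 0 < n := by linarith
  have h1 : √q ≤ 1 / (2 * l) := by
    refine Real.sqrt_le_iff.2 ⟨by positivity, ?_⟩
    rw [div_pow, le_div_iff₀ (by positivity)]
    linarith
  have h2 : 1 / n ≤ 1 / (2 * l) := by
    rw [div_le_one hn0] at hln'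
    exact one_div_le_one_div_of_le (by positivity) hln'
  have hlog : Real.log 2 ≤ 1 := by linarith [Real.log_two_lt_d9]
  have h3 : √q * N / n + N / n ^ 2 ≤ N / (n * l) := by
    have : √q * N / n + N / n ^ 2 = (√q + 1 / n) * (N / n) := by field_simp
    rw [this]
    have h4 : N / (n * l) = (1 / (2 * l) + 1 / (2 * l)) * (N / n) := by field_simp; norm_num
    rw [h4]
    gcongr
  have hx : 0 < N / (n * l) := by positivity
  have h5 : (2 : ℝ) ^ (√q * N / n + N / n ^ 2) * Real.exp (-(2 / l * N / n))
      ≤ Real.exp (-(N / (n * l))) := by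
    rw [Real.rpow_def_of_pos two_pos, ← Real.exp_add, Real.exp_le_exp]
    have h6 : 2 / l * N / n = 2 * (N / (n * l)) := by field_simp
    rw [h6]
    have h7 : 0 ≤ √q * N / n + N / n ^ 2 := by positivity
    nlinarith
  have h8 : Real.exp (-(N / (n * l))) ≤ 2 * n ^ 2 / N := by
    rw [Real.exp_neg]
    have h9 := Real.add_one_le_exp (N / (n * l))
    calc (Real.exp (N / (n * l)))⁻¹ ≤ (N / (n * l))⁻¹ := by
          gcongr; linarith
      _ = n * l / N := by rw [inv_div]
      _ ≤ 2 * n ^ 2 / N := div_le_div_of_nonneg_right (by nlinarith) hN.le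
  linarith

lemma two_div_twiceLog_le {m : ℕ} (hl : 8 ≤ twiceLog m) :
    2 / twiceLog m ≤ 100 * Real.log 2 / Real.logb 2 (Real.logb 2 ((m + 1 : ℕ) : ℝ)) := by
  have h2 : 0.69 < Real.log 2 := by linarith [Real.log_two_gt_d9]
  set x := Real.logb 2 ((m + 1 : ℕ) : ℝ) with hx
  have ht : twiceLog m = 2 * x := by rw [twiceLog, hx]; push_cast; rfl
  rw [ht] at hl ⊢
  have hx4 : 4 ≤ x := by linarith
  have hpos : 0 < Real.logb 2 x := Real.logb_pos one_lt_two (by linarith)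
  have hle : Real.logb 2 x ≤ 100 * Real.log 2 * x := by
    rw [Real.logb, div_le_iff₀ (by linarith)]
    have := Real.log_le_sub_one_of_pos (by linarith : 0 < x)
    have hsq : 1 ≤ 100 * Real.log 2 * Real.log 2 := by nlinarith
    nlinarith
  rw [div_le_div_iff₀ (by linarith) hpos]
  linarith

lemma one_sub_le_prob_large_component {m : ℕ} (hm : 1 ≤ m) (hl : 8 ≤ twiceLog m)
    (hq : 4 * ((6 * twiceLog m ^ 2) ^ 4 * 2 / ((m : ℝ) + 1)) * twiceLog m ^ 2 ≤ 1)
    (hln : 2 * twiceLog m / ((m : ℝ) + 1) ≤ 1) :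
    1 - (1 / (2 * twiceLog m) + 2 * ((m : ℝ) + 1) ^ 2 / 2 ^ (m + 1)) ≤
      prob (fun ω : KOut (m + 1) 2 => ∃ v : Vtx (m + 1),
        (1 - 100 * Real.log 2 / Real.logb 2 (Real.logb 2 ((m + 1 : ℕ) : ℝ))) * 2 ^ (m + 1)
          ≤ (compSize (kOutGraph (m + 1) 2 ω) v : ℝ)) := by
  set l := twiceLog m with hldef
  set q : ℝ := (6 * l ^ 2) ^ 4 * 2 / ((m : ℝ) + 1) with hqdef
  have hq0 : 0 ≤ q := by positivity
  have hq1 : q ≤ 1 := by nlinarith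
  set e : ℝ := 2 / l * 2 ^ (m + 1) with he
  have hN : (0 : ℝ) < 2 ^ (m + 1) := by positivity
  have hl0 : 0 < l := by linarith
  have hε : 2 / l ≤ 1 / 4 := by
    rw [div_le_div_iff₀ hl0 (by norm_num)]
    linarith
  have hMl : Real.logb 2 (((m + 1) ^ 2 : ℕ) : ℝ) ≤ l := by
    rw [hldef, twiceLog]
    push_cast
    rw [Real.logb_pow]
    norm_num
  have hcut := card_badCut_prod_le hm e (M := (m + 1) ^ 2) (by positivity) (by linarith) hMl
    hqdef hq1
  have hfail := failure_bound_le (N := 2 ^ (m + 1)) (n := (m : ℝ) + 1) hN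
    (by linarith [(Nat.cast_nonneg m : (0 : ℝ) ≤ m)]) (by linarith) (twiceLog_le m) hq hln
  refine one_sub_le_prob hm _ (BadCut e) _ (hcut.trans ?_) fun z h hb => ?_
  · refine mul_le_mul_of_nonneg_left (le_trans (le_of_eq ?_) hfail) (Nat.cast_nonneg _)
    push_cast
    rfl
  · obtain ⟨v, hv⟩ := exists_large_component_of_not_badCut (by positivity)
      (by rw [he]; nlinarith) z h hb
    refine ⟨v, le_trans ?_ hv⟩
    have := mul_le_mul_of_nonneg_right (two_div_twiceLog_le hl) hN.le
    rw [he]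
    linarith

/-- W.h.p. `Q^n(2)` contains a connected component with at least
`(1 − (100·ln 2)/log₂log₂ n)·2^n` vertices. -/
theorem stmt_3 :
    Tendsto (fun n : ℕ =>
        prob (fun ω : KOut n 2 =>
          ∃ v : Vtx n,
            (1 - 100 * Real.log 2 / Real.logb 2 (Real.logb 2 n)) * 2 ^ n
              ≤ (compSize (kOutGraph n 2 ω) v : ℝ)))
      atTop (nhds 1) := by
  refine (tendsto_add_atTop_iff_nat 1).1 ?_
  have hfail : Tendsto (fun m : ℕ =>
      1 - (1 / (2 * twiceLog m) + 2 * ((m : ℝ) + 1) ^ 2 / 2 ^ (m + 1))) atTop (nhds 1) := by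
    have h1 : Tendsto (fun m : ℕ => 1 / (2 * twiceLog m)) atTop (nhds 0) :=
      (tendsto_twiceLog.const_mul_atTop two_pos).const_div_atTop 1
    have h2 : Tendsto (fun m : ℕ => 2 * ((m : ℝ) + 1) ^ 2 / 2 ^ (m + 1)) atTop (nhds 0) := by
      have h3 := ((tendsto_pow_const_div_const_pow_of_one_lt 2 (one_lt_two (α := ℝ))).const_mul
        2).comp (tendsto_add_atTop_nat 1)
      simpa [Function.comp_def, mul_div_assoc] using h3
    simpa using (h1.add h2).const_sub 1
  have hq : ∀ᶠ m : ℕ in atTop,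
      4 * ((6 * twiceLog m ^ 2) ^ 4 * 2 / ((m : ℝ) + 1)) * twiceLog m ^ 2 ≤ 1 := by
    filter_upwards [(tendsto_twiceLog_pow_mul_div 10 (8 * 6 ^ 4)).eventually_le_const one_pos]
      with m hm
    refine le_trans (le_of_eq ?_) hm
    ring
  have hln : ∀ᶠ m : ℕ in atTop, 2 * twiceLog m / ((m : ℝ) + 1) ≤ 1 := by
    simpa using (tendsto_twiceLog_pow_mul_div 1 2).eventually_le_const one_pos
  refine tendsto_of_tendsto_of_tendsto_of_le_of_le' hfail tendsto_const_nhds ?_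
    (Eventually.of_forall fun m => prob_le_one _)
  filter_upwards [eventually_ge_atTop 1, tendsto_twiceLog.eventually_ge_atTop 8, hq, hln]
    with m h1 h2 h3 h4
  exact one_sub_le_prob_large_component h1 h2 h3 h4
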